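/- For every k ≥ 2: b_k·D_k = (1 + a_k·D_k²)·(D_{k-1}·D_{k-2}⋯D₂), where the product D_{k-1}⋯D₂ is the empty product 1 when k = 2. Equivalently, with d_k := 1/a_k and ℓ_k := 1/b_k (both a_k and b_k being nonzero): ℓ_k = D_k·d_k / ((d_k + D_k²)·(D_{k-1}·D_{k-2}⋯D₂)). This expresses the logarithm denominators ℓ_k in terms of the d_k and the products D_i of all monic elements of A of degree i. -/

import Mathlib

noncomputable section

open Polynomial
open scoped Classical

/-- The defining polynomial `Y² + Y + (X³ + X + 1)` over `𝔽₂[X]`,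
viewed as a polynomial in `Y` with coefficients in `𝔽₂[X]`. -/
def curveEq : Polynomial (Polynomial (ZMod 2)) :=
  X ^ 2 + X + C (X ^ 3 + X + 1)

/-- The ring `A = 𝔽₂[X,Y]/(Y² + Y + X³ + X + 1)`. -/
abbrev A : Type := AdjoinRoot curveEq

/-- The image `x` of `X` in `A`. -/
def aX : A := AdjoinRoot.of curveEq (X : Polynomial (ZMod 2))

/-- The image `y` of `Y` in `A`. -/
def aY : A := AdjoinRoot.root curveEq

/-- The bracket `[j]_x = x^{2^j} + x ∈ A`. -/
def brX (j : ℕ) : A := aX ^ 2 ^ j + aX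

/-- The monomials `xⁱyʲ` with `j ∈ {0,1}` and `2i + 3j < k`. -/
def monoSet (k : ℕ) : Finset A :=
  ((Finset.range k ×ˢ Finset.range 2).filter fun p => 2 * p.1 + 3 * p.2 < k).image
    fun p => aX ^ p.1 * aY ^ p.2

/-- `A_{<k}` : the `𝔽₂`-linear span of the monomials `xⁱyʲ` with `j ∈ {0,1}`
and `2i + 3j < k`, realized as the finite set of all subset sums. -/
def Alt (k : ℕ) : Finset A := (monoSet k).powerset.image fun s => s.sum id

/-- `t_k := x^{k/2}` if `k` is even, `t_k := y·x^{(k-3)/2}` if `k` is odd. -/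
def tk (k : ℕ) : A := if Even k then aX ^ (k / 2) else aY * aX ^ ((k - 3) / 2)

/-- `e_k(w) := ∏_{a ∈ A_{<k}} (w + a) ∈ A[w]`. -/
def ePoly (k : ℕ) : Polynomial A := ∏ a ∈ Alt k, (X + C a)

/-- `D_k := e_k(t_k)`, the product of all monic elements of `A` of degree `k`. -/
def Dk (k : ℕ) : A := (ePoly k).eval (tk k)

variable (K : Type) [Field K] [Algebra A K]

/-- The coefficients `a_j = 1/d_j` of the exponential function:
`a₀ = a₁ = 1` and `a_j = ([1]_x·a_{j-1}² + a_{j-2}⁴)/[j]_x` for `j ≥ 2`. -/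
def aSeq : ℕ → K
  | 0 => 1
  | 1 => 1
  | (j + 2) =>
      (algebraMap A K (brX 1) * (aSeq (j + 1)) ^ 2 + (aSeq j) ^ 4) /
        algebraMap A K (brX (j + 2))

/-- The coefficients `b_j = 1/ℓ_j` of the logarithm function:
`b₀ = b₁ = 1` and `b_j = ([1]_x^{2^{j-1}}·b_{j-1} + b_{j-2})/[j]_x` for `j ≥ 2`. -/
def bSeq : ℕ → K
  | 0 => 1
  | 1 => 1
  | (j + 2) =>
      (algebraMap A K (brX 1) ^ 2 ^ (j + 1) * bSeq (j + 1) + bSeq j) /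
        algebraMap A K (brX (j + 2))

/-- `p_k(w) := Σ_{j=0}^{k} a_j·b_{k-j}^{2^j}·w^{2^j} ∈ K[w]`. -/
def pPoly (k : ℕ) : Polynomial K :=
  ∑ j ∈ Finset.range (k + 1), C (aSeq K j * (bSeq K (k - j)) ^ 2 ^ j) * X ^ 2 ^ j

/-- `S_{n,r}(x₁,…,x_n) := Σ_{n ≥ i₁ > i₂ > … > i_r ≥ 1} ∏_{j=1}^{r}
x_{i_j}^{2^{n-j+1-i_j}}`, with `S_{n,0} = 1` and `S_{n,r} = 0` for `r > n`. -/
def Ssum (R : Type*) [CommRing R] (n r : ℕ) (x : ℕ → R) : R :=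
  ∑ f ∈ Finset.univ.filter
      (fun f : Fin r → Fin (n + 1) => StrictAnti f ∧ ∀ j, 1 ≤ (f j : ℕ)),
    ∏ j : Fin r, x (f j) ^ 2 ^ (n - (j : ℕ) - (f j : ℕ))

theorem two_eq_zero_coordinateRing : (2 : A) = 0 := by
  have h : (2 : ZMod 2) = 0 := by decide
  have h' := congrArg (fun c => AdjoinRoot.of curveEq (C c)) h
  simpa only [map_ofNat, map_zero] using h'

theorem add_self_coordinateRing (a : A) : a + a = 0 := by
  rw [← two_mul, two_eq_zero_coordinateRing, zero_mul]

theorem aY_sq_add_aY : aY ^ 2 + aY = aX ^ 3 + aX + 1 := by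
  have h : aY ^ 2 + aY + (aX ^ 3 + aX + 1) = 0 := by
    have h' : AdjoinRoot.mk curveEq (X ^ 2 + X + C (X ^ 3 + X + 1)) = 0 := AdjoinRoot.mk_self
    rwa [map_add, map_add, map_pow, AdjoinRoot.mk_X, AdjoinRoot.mk_C, map_add, map_add, map_pow,
      map_one] at h'
  linear_combination h - add_self_coordinateRing (aX ^ 3 + aX + 1)

theorem degree_curveEq : curveEq.degree = 2 := by
  unfold curveEq
  compute_degree!

theorem one_ne_zero_coordinateRing : (1 : A) ≠ 0 := fun h => by
  have hm : curveEq.degree ≠ 0 := by rw [degree_curveEq]; decide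
  refine one_ne_zero (AdjoinRoot.of.injective_of_degree_ne_zero hm (a₁ := 1) (a₂ := 0) ?_)
  rw [map_one, map_zero, h]

theorem brX_ne_zero {j : ℕ} (hj : 1 ≤ j) : brX j ≠ 0 := by
  have hm : curveEq.degree ≠ 0 := by rw [degree_curveEq]; decide
  intro h
  have h' : (X ^ 2 ^ j + X : Polynomial (ZMod 2)) = 0 := by
    apply AdjoinRoot.of.injective_of_degree_ne_zero hm
    simpa only [brX, aX, map_add, map_pow, map_zero] using h
  have hc := congrArg (fun p => p.coeff 1) h'
  have h1 : 1 ≠ 2 ^ j := (Nat.one_lt_two_pow (by omega)).ne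
  simp [coeff_X_pow, h1] at hc

theorem charP_two_of_fractionRing [IsFractionRing A K] : CharP K 2 := by
  have h2 : (2 : K) = 0 := by
    simpa only [map_ofNat, map_zero] using congrArg (algebraMap A K) two_eq_zero_coordinateRing
  exact CharTwo.of_one_ne_zero_of_two_eq_zero one_ne_zero h2

theorem algebraMap_brX (j : ℕ) :
    algebraMap A K (brX j) = algebraMap A K aX ^ 2 ^ j + algebraMap A K aX := by
  simp only [brX, map_add, map_pow]

theorem algebraMap_brX_ne_zero [IsFractionRing A K] {j : ℕ} (hj : 1 ≤ j) :
    algebraMap A K (brX j) ≠ 0 := fun h =>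
  brX_ne_zero hj (IsFractionRing.injective A K (by rw [h, map_zero]))

theorem brX_mul_aSeq [IsFractionRing A K] (j : ℕ) :
    algebraMap A K (brX (j + 2)) * aSeq K (j + 2) =
      algebraMap A K (brX 1) * aSeq K (j + 1) ^ 2 + aSeq K j ^ 4 := by
  rw [aSeq, mul_div_cancel₀ _ (algebraMap_brX_ne_zero K (by omega))]

theorem brX_mul_bSeq [IsFractionRing A K] (j : ℕ) :
    algebraMap A K (brX (j + 2)) * bSeq K (j + 2) =
      algebraMap A K (brX 1) ^ 2 ^ (j + 1) * bSeq K (j + 1) + bSeq K j := by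
  rw [bSeq, mul_div_cancel₀ _ (algebraMap_brX_ne_zero K (by omega))]

/-- The coefficient of `w ^ 2 ^ k` in `exp (z * log w)`, i.e. the value of `pPoly K k` at `z`. -/
def expLogCoeff (k : ℕ) (z : K) : K :=
  ∑ p ∈ Finset.HasAntidiagonal.antidiagonal k, aSeq K p.1 * bSeq K p.2 ^ 2 ^ p.1 * z ^ 2 ^ p.1

theorem expLogCoeff_zero_right (k : ℕ) : expLogCoeff K k 0 = 0 := by
  simp [expLogCoeff]

theorem expLogCoeff_add [CharP K 2] (k : ℕ) (z w : K) :
    expLogCoeff K k (z + w) = expLogCoeff K k z + expLogCoeff K k w := by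
  simp only [expLogCoeff, add_pow_char_pow, mul_add, Finset.sum_add_distrib]

theorem expLogCoeff_zero (z : K) : expLogCoeff K 0 z = z := by
  simp [expLogCoeff, aSeq, bSeq]

theorem expLogCoeff_one (z : K) : expLogCoeff K 1 z = z + z ^ 2 := by
  simp [expLogCoeff, aSeq, bSeq, Finset.Nat.sum_antidiagonal_succ]

/-- The functional equation of the exponential function. -/
theorem expLogCoeff_aX_mul [IsFractionRing A K] [CharP K 2] (k : ℕ) (z : K) :
    expLogCoeff K (k + 2) (algebraMap A K aX * z) =
      algebraMap A K aX * expLogCoeff K (k + 2) z +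
        algebraMap A K (brX 1) * expLogCoeff K (k + 1) z ^ 2 + expLogCoeff K k z ^ 4 := by
  have h4 : ∀ w : K, w ^ 4 = w ^ 2 ^ 2 := fun w => by norm_num
  simp only [expLogCoeff, Finset.Nat.sum_antidiagonal_succ]
  rw [h4, sum_pow_char_pow 2 2, add_pow_char, sum_pow_char 2]
  have key : ∀ p : ℕ × ℕ, aSeq K (p.1 + 1 + 1) * bSeq K p.2 ^ 2 ^ (p.1 + 1 + 1) *
        (algebraMap A K aX * z) ^ 2 ^ (p.1 + 1 + 1) =
      algebraMap A K aX *
          (aSeq K (p.1 + 1 + 1) * bSeq K p.2 ^ 2 ^ (p.1 + 1 + 1) * z ^ 2 ^ (p.1 + 1 + 1)) +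
        algebraMap A K (brX 1) *
          (aSeq K (p.1 + 1) * bSeq K p.2 ^ 2 ^ (p.1 + 1) * z ^ 2 ^ (p.1 + 1)) ^ 2 +
        (aSeq K p.1 * bSeq K p.2 ^ 2 ^ p.1 * z ^ 2 ^ p.1) ^ 2 ^ 2 := by
    intro p
    have h := brX_mul_aSeq K p.1
    rw [algebraMap_brX K (p.1 + 2)] at h
    simp only [mul_pow, ← pow_mul, ← pow_succ, ← pow_add]
    have h2 : (2 : K) = 0 := CharTwo.two_eq_zero
    linear_combination (bSeq K p.2 ^ 2 ^ (p.1 + 2) * z ^ 2 ^ (p.1 + 2)) * h -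
      algebraMap A K aX * aSeq K (p.1 + 2) * bSeq K p.2 ^ 2 ^ (p.1 + 2) * z ^ 2 ^ (p.1 + 2) * h2
  simp only [key, Finset.sum_add_distrib, ← Finset.mul_sum]
  simp only [algebraMap_brX, aSeq, zero_add, pow_zero, pow_one]
  have h2 : (2 : K) = 0 := CharTwo.two_eq_zero
  linear_combination (-(algebraMap A K aX) * bSeq K (k + 1) ^ 2 * z ^ 2) * h2

/-- The functional equation of the logarithm function. -/
theorem expLogCoeff_aX_mul' [IsFractionRing A K] [CharP K 2] (k : ℕ) (z : K) :
    expLogCoeff K (k + 2) (algebraMap A K aX * z) =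
      algebraMap A K aX ^ 2 ^ (k + 2) * expLogCoeff K (k + 2) z +
        algebraMap A K (brX 1) ^ 2 ^ (k + 1) * expLogCoeff K (k + 1) z + expLogCoeff K k z := by
  simp only [expLogCoeff, Finset.Nat.sum_antidiagonal_succ']
  have h2 : (2 : K) = 0 := CharTwo.two_eq_zero
  have key : ∀ p ∈ Finset.HasAntidiagonal.antidiagonal k,
      aSeq K p.1 * bSeq K (p.2 + 1 + 1) ^ 2 ^ p.1 * (algebraMap A K aX * z) ^ 2 ^ p.1 =
      algebraMap A K aX ^ 2 ^ (k + 2) *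
          (aSeq K p.1 * bSeq K (p.2 + 1 + 1) ^ 2 ^ p.1 * z ^ 2 ^ p.1) +
        algebraMap A K (brX 1) ^ 2 ^ (k + 1) *
          (aSeq K p.1 * bSeq K (p.2 + 1) ^ 2 ^ p.1 * z ^ 2 ^ p.1) +
        aSeq K p.1 * bSeq K p.2 ^ 2 ^ p.1 * z ^ 2 ^ p.1 := by
    rintro ⟨i, j⟩ hp
    obtain rfl : i + j = k := by simpa using hp
    have h := congrArg (· ^ 2 ^ i) (brX_mul_bSeq K j)
    simp only [algebraMap_brX K (j + 2), mul_pow, add_pow_char_pow, ← pow_mul, ← pow_add] at h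
    rw [show j + 2 + i = i + j + 2 by ring, show j + 1 + i = i + j + 1 by ring] at h
    simp only [mul_pow]
    linear_combination (aSeq K i * z ^ 2 ^ i) * h -
      aSeq K i * z ^ 2 ^ i * algebraMap A K aX ^ 2 ^ (i + j + 2) * bSeq K (j + 2) ^ 2 ^ i * h2
  simp only [Finset.sum_congr rfl key, Finset.sum_add_distrib, ← Finset.mul_sum]
  simp only [algebraMap_brX, bSeq, pow_one, one_pow, add_pow_char_pow, ← pow_mul,
    mul_pow, ← pow_succ', add_assoc, Nat.reduceAdd]
  linear_combination (-aSeq K (k + 1) * algebraMap A K aX ^ 2 ^ (k + 2) * z ^ 2 ^ (k + 1)) * h2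

theorem brX_mul_expLogCoeff [IsFractionRing A K] [CharP K 2] (k : ℕ) (z : K) :
    algebraMap A K (brX (k + 2)) * expLogCoeff K (k + 2) z =
      algebraMap A K (brX 1) ^ 2 ^ (k + 1) * expLogCoeff K (k + 1) z + expLogCoeff K k z +
        algebraMap A K (brX 1) * expLogCoeff K (k + 1) z ^ 2 + expLogCoeff K k z ^ 4 := by
  have h := (expLogCoeff_aX_mul K k z).symm.trans (expLogCoeff_aX_mul' K k z)
  have h2 : (2 : K) = 0 := CharTwo.two_eq_zero
  rw [algebraMap_brX K (k + 2)]
  linear_combination h + (algebraMap A K aX ^ 2 ^ (k + 2) * expLogCoeff K (k + 2) z -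
    algebraMap A K (brX 1) * expLogCoeff K (k + 1) z ^ 2 - expLogCoeff K k z ^ 4) * h2

theorem expLogCoeff_add_two_eq_zero [IsFractionRing A K] [CharP K 2] {k : ℕ} {z : K}
    (h0 : expLogCoeff K k z = 0 ∨ expLogCoeff K k z = 1) (h1 : expLogCoeff K (k + 1) z = 0) :
    expLogCoeff K (k + 2) z = 0 := by
  have h := brX_mul_expLogCoeff K k z
  have h' : algebraMap A K (brX (k + 2)) * expLogCoeff K (k + 2) z = 0 := by
    rcases h0 with h0 | h0 <;> simp [h, h0, h1, CharTwo.add_self_eq_zero]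
  exact (mul_eq_zero.mp h').resolve_left (algebraMap_brX_ne_zero K (by omega))

theorem expLogCoeff_eq_zero_of_lt [IsFractionRing A K] [CharP K 2] {d : ℕ} {z : K}
    (h0 : expLogCoeff K d z = 1) (h1 : expLogCoeff K (d + 1) z = 0) {k : ℕ} (hk : d < k) :
    expLogCoeff K k z = 0 := by
  have h : ∀ n, expLogCoeff K (d + n + 1) z = 0 ∧ expLogCoeff K (d + n + 2) z = 0 := by
    intro n
    induction n with
    | zero => exact ⟨h1, expLogCoeff_add_two_eq_zero K (Or.inr h0) h1⟩
    | succ n ih => exact ⟨ih.2, expLogCoeff_add_two_eq_zero K (Or.inl ih.1) ih.2⟩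
  obtain ⟨n, rfl⟩ : ∃ n, k = d + n + 1 := ⟨k - d - 1, by omega⟩
  exact (h n).1

theorem expLogCoeff_aX_pow_mul [IsFractionRing A K] [CharP K 2] {d : ℕ} {z : K}
    (h0 : expLogCoeff K d z = 1) (h1 : ∀ k, d < k → expLogCoeff K k z = 0) (n : ℕ) :
    expLogCoeff K (2 * n + d) (algebraMap A K aX ^ n * z) = 1 ∧
      ∀ k, 2 * n + d < k → expLogCoeff K k (algebraMap A K aX ^ n * z) = 0 := by
  induction n with
  | zero => simpa using ⟨h0, h1⟩
  | succ n ih =>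
    rw [pow_succ', mul_assoc]
    refine ⟨?_, fun k hk => ?_⟩
    · rw [show 2 * (n + 1) + d = 2 * n + d + 2 by ring, expLogCoeff_aX_mul, ih.1,
        ih.2 _ (by omega), ih.2 _ (by omega)]
      simp
    · obtain ⟨m, rfl⟩ : ∃ m, k = m + 2 := ⟨k - 2, by omega⟩
      rw [expLogCoeff_aX_mul, ih.2 _ (by omega), ih.2 _ (by omega), ih.2 _ (by omega)]
      simp

theorem expLogCoeff_one_right [IsFractionRing A K] [CharP K 2] {k : ℕ} (hk : 0 < k) :
    expLogCoeff K k 1 = 0 :=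
  expLogCoeff_eq_zero_of_lt K (expLogCoeff_zero K 1)
    (by simp [expLogCoeff_one, CharTwo.add_self_eq_zero]) hk

theorem expLogCoeff_aY [IsFractionRing A K] [CharP K 2] :
    expLogCoeff K 3 (algebraMap A K aY) = 1 ∧ expLogCoeff K 4 (algebraMap A K aY) = 0 := by
  have hy : algebraMap A K aY ^ 2 + algebraMap A K aY =
      algebraMap A K aX ^ 3 + algebraMap A K aX + 1 := by
    simpa only [map_add, map_pow, map_one] using congrArg (algebraMap A K) aY_sq_add_aY
  have e2 := brX_mul_expLogCoeff K 0 (algebraMap A K aY)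
  have e3 := brX_mul_expLogCoeff K 1 (algebraMap A K aY)
  have e4 := brX_mul_expLogCoeff K 2 (algebraMap A K aY)
  have n2 := algebraMap_brX_ne_zero K (j := 2) (by omega)
  have n3 := algebraMap_brX_ne_zero K (j := 3) (by omega)
  have n4 := algebraMap_brX_ne_zero K (j := 4) (by omega)
  simp only [algebraMap_brX, Nat.reduceAdd, Nat.reducePow, zero_add] at e2 e3 e4 n2 n3 n4
  simp only [expLogCoeff_zero, expLogCoeff_one] at e2 e3
  generalize algebraMap A K aX = x at *
  generalize algebraMap A K aY = y at *
  have hy' : y + y ^ 2 = x ^ 3 + x + 1 := by rw [← hy, add_comm]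
  have hy4 : y + y ^ 4 = (x ^ 3 + x + 1) + (x ^ 3 + x + 1) ^ 2 := by
    rw [← hy]
    grind
  rw [hy'] at e2 e3
  have v2 : expLogCoeff K 2 y = x * (x ^ 3 + x + 1) := by
    refine mul_left_cancel₀ n2 ?_
    rw [e2]
    grind
  rw [v2] at e3 e4
  have v3 : expLogCoeff K 3 y = 1 := by
    refine mul_left_cancel₀ n3 ?_
    rw [e3]
    grind
  refine ⟨v3, ?_⟩
  rw [v3] at e4
  refine mul_left_cancel₀ n4 ?_
  rw [e4]
  grind

theorem expLogCoeff_monomial [IsFractionRing A K] [CharP K 2] (i : ℕ) {j : ℕ} (hj : j < 2) :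
    expLogCoeff K (2 * i + 3 * j) (algebraMap A K (aX ^ i * aY ^ j)) = 1 ∧
      ∀ k, 2 * i + 3 * j < k → expLogCoeff K k (algebraMap A K (aX ^ i * aY ^ j)) = 0 := by
  rw [map_mul, map_pow]
  interval_cases j
  · simpa using expLogCoeff_aX_pow_mul K (expLogCoeff_zero K 1)
      (fun k hk => expLogCoeff_one_right K hk) i
  · simpa using expLogCoeff_aX_pow_mul K (expLogCoeff_aY K).1
      (fun k hk => expLogCoeff_eq_zero_of_lt K (expLogCoeff_aY K).1 (expLogCoeff_aY K).2 hk) i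

theorem tk_eq_monomial {k : ℕ} (hk : 2 ≤ k) :
    ∃ i j, j < 2 ∧ 2 * i + 3 * j = k ∧ tk k = aX ^ i * aY ^ j := by
  by_cases h : Even k
  · refine ⟨k / 2, 0, by omega, ?_, by simp [tk, h]⟩
    have := Nat.even_iff.mp h
    omega
  · refine ⟨(k - 3) / 2, 1, by omega, ?_, by simp [tk, h, mul_comm]⟩
    have := Nat.not_even_iff.mp h
    omega

theorem expLogCoeff_tk [IsFractionRing A K] [CharP K 2] {k : ℕ} (hk : 2 ≤ k) :
    expLogCoeff K k (algebraMap A K (tk k)) = 1 := by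
  obtain ⟨i, j, hj, rfl, h⟩ := tk_eq_monomial hk
  rw [h]
  exact (expLogCoeff_monomial K i hj).1

theorem expLogCoeff_eq_zero_of_mem_Alt [IsFractionRing A K] [CharP K 2] {k : ℕ} {a : A}
    (ha : a ∈ Alt k) : expLogCoeff K k (algebraMap A K a) = 0 := by
  obtain ⟨s, hs, rfl⟩ := Finset.mem_image.mp ha
  refine Finset.sum_induction _ (fun a => expLogCoeff K k (algebraMap A K a) = 0) ?_ ?_ ?_
  · intro a b ha hb
    rw [map_add, expLogCoeff_add, ha, hb, add_zero]
  · rw [map_zero, expLogCoeff_zero_right]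
  · intro a ha
    obtain ⟨⟨i, j⟩, hp, rfl⟩ := Finset.mem_image.mp (Finset.mem_powerset.mp hs ha)
    simp only [Finset.mem_filter, Finset.mem_product, Finset.mem_range] at hp
    exact (expLogCoeff_monomial K i hp.1.2).2 k hp.2

theorem add_mem_Alt {k : ℕ} {a b : A} (ha : a ∈ Alt k) (hb : b ∈ Alt k) : a + b ∈ Alt k := by
  obtain ⟨s, hs, rfl⟩ := Finset.mem_image.mp ha
  obtain ⟨t, ht, rfl⟩ := Finset.mem_image.mp hb
  rw [Finset.mem_powerset] at hs ht
  refine Finset.mem_image.mpr ⟨symmDiff s t, Finset.mem_powerset.mpr ?_, ?_⟩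
  · intro a ha
    rcases Finset.mem_symmDiff.mp ha with h | h
    · exact hs h.1
    · exact ht h.1
  · have h1 := Finset.sum_sdiff (f := (id : A → A)) (Finset.inter_subset_left (s₁ := s) (s₂ := t))
    have h2 := Finset.sum_sdiff (f := (id : A → A)) (Finset.inter_subset_right (s₁ := s) (s₂ := t))
    rw [Finset.sdiff_inter_self_left] at h1
    rw [Finset.sdiff_inter_self_right] at h2
    have h3 : (symmDiff s t).sum (id : A → A) = (s \ t).sum id + (t \ s).sum id := by
      rw [symmDiff_def, Finset.sup_eq_union, Finset.sum_union disjoint_sdiff_sdiff]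
    rw [h3]
    linear_combination h1 + h2 - add_self_coordinateRing ((s ∩ t).sum id)

theorem monoSet_subset_Alt (k : ℕ) : monoSet k ⊆ Alt k := fun a ha =>
  Finset.mem_image.mpr ⟨{a}, by simpa using ha, by simp⟩

theorem monoSet_succ {k : ℕ} (hk : 2 ≤ k) : monoSet (k + 1) = insert (tk k) (monoSet k) := by
  obtain ⟨i, j, hj, hij, h⟩ := tk_eq_monomial hk
  ext a
  simp only [monoSet, Finset.mem_insert, Finset.mem_image, Finset.mem_filter,
    Finset.mem_product, Finset.mem_range, Prod.exists]
  constructor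
  · rintro ⟨i', j', ⟨⟨-, hj'⟩, hlt⟩, rfl⟩
    rcases Nat.lt_succ_iff_lt_or_eq.mp hlt with hlt | heq
    · exact Or.inr ⟨i', j', ⟨⟨by omega, hj'⟩, hlt⟩, rfl⟩
    · obtain rfl : j' = j := by omega
      obtain rfl : i' = i := by omega
      exact Or.inl h.symm
  · rintro (rfl | ⟨i', j', ⟨⟨hi', hj'⟩, hlt⟩, rfl⟩)
    · exact ⟨i, j, ⟨⟨by omega, hj⟩, by omega⟩, h.symm⟩
    · exact ⟨i', j', ⟨⟨by omega, hj'⟩, by omega⟩, rfl⟩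

theorem Alt_two : Alt 2 = {0, 1} := by
  have h : monoSet 2 = {1} := by
    have : (Finset.range 2 ×ˢ Finset.range 2).filter (fun p => 2 * p.1 + 3 * p.2 < 2)
        = {(0, 0)} := by decide
    rw [monoSet, this]
    simp
  rw [Alt, h]
  ext a
  simp only [Finset.mem_image, Finset.mem_powerset, Finset.subset_singleton_iff]
  aesop

theorem tk_notMem_Alt [IsFractionRing A K] [CharP K 2] {k : ℕ} (hk : 2 ≤ k) : tk k ∉ Alt k :=
  fun h => one_ne_zero ((expLogCoeff_tk K hk).symm.trans (expLogCoeff_eq_zero_of_mem_Alt K h))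

theorem Alt_succ [IsFractionRing A K] [CharP K 2] {k : ℕ} (hk : 2 ≤ k) :
    Alt (k + 1) = Alt k ∪ (Alt k).image (tk k + ·) := by
  have hmem : tk k ∉ monoSet k := fun h => tk_notMem_Alt K hk (monoSet_subset_Alt k h)
  rw [Alt, monoSet_succ hk, Finset.powerset_insert, Finset.image_union, Alt, Finset.image_image,
    Finset.image_image]
  congr 1
  refine Finset.image_congr fun s hs => ?_
  have hs' : tk k ∉ s := fun h => hmem (Finset.mem_powerset.mp hs h)
  simp [Finset.sum_insert hs']

theorem disjoint_Alt_translate [IsFractionRing A K] [CharP K 2] {k : ℕ} (hk : 2 ≤ k) :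
    Disjoint (Alt k) ((Alt k).image (tk k + ·)) := by
  rw [Finset.disjoint_right]
  intro b hb hb'
  obtain ⟨a, ha, rfl⟩ := Finset.mem_image.mp hb
  refine tk_notMem_Alt K hk ?_
  have h := add_mem_Alt hb' ha
  rwa [add_assoc, add_self_coordinateRing, add_zero] at h

theorem card_Alt [IsFractionRing A K] [CharP K 2] (n : ℕ) : (Alt (n + 2)).card = 2 ^ (n + 1) := by
  induction n with
  | zero => rw [Alt_two, Finset.card_pair one_ne_zero_coordinateRing.symm, zero_add, pow_one]
  | succ n ih =>
    rw [Alt_succ K (by omega), Finset.card_union_of_disjoint (disjoint_Alt_translate K (by omega)),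
      Finset.card_image_of_injective _ (add_right_injective _), ih]
    ring

theorem algebraMap_Dk (k : ℕ) : algebraMap A K (Dk k) =
    ∏ a ∈ Alt k, (algebraMap A K (tk k) + algebraMap A K a) := by
  simp [Dk, ePoly, eval_prod]

/-- `ePoly (n + 2)` is a monic linearized polynomial of degree `2 ^ (n + 1)` whose linear
coefficient is the product of the `Dk j` with `2 ≤ j < n + 2`. -/
theorem exists_linearized_prod_Alt [IsFractionRing A K] [CharP K 2] (n : ℕ) :
    ∃ c : ℕ → K, (∀ w, ∏ a ∈ Alt (n + 2), (w + algebraMap A K a) =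
        ∑ j ∈ Finset.range (n + 2), c j * w ^ 2 ^ j) ∧
      c 0 = ∏ j ∈ Finset.Icc 2 (n + 1), algebraMap A K (Dk j) ∧
      c (n + 1) = 1 ∧ c (n + 2) = 0 := by
  induction n with
  | zero =>
    refine ⟨fun j => if j < 2 then 1 else 0, fun w => ?_, by simp, by simp, by simp⟩
    rw [Alt_two, Finset.prod_pair one_ne_zero_coordinateRing.symm]
    simp [Finset.sum_range_succ]
    ring
  | succ n ih =>
    obtain ⟨c, hc, h0, h1, h2⟩ := ih
    set D := algebraMap A K (Dk (n + 2)) with hD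
    have hDc : D = ∑ j ∈ Finset.range (n + 2), c j * algebraMap A K (tk (n + 2)) ^ 2 ^ j := by
      rw [hD, algebraMap_Dk, hc]
    obtain ⟨c', hc0, hcs⟩ : ∃ c' : ℕ → K, c' 0 = D * c 0 ∧
        ∀ i, c' (i + 1) = if i < n + 2 then c i ^ 2 + D * c (i + 1) else 0 :=
      ⟨fun j => Nat.casesOn j (D * c 0)
        fun i => if i < n + 2 then c i ^ 2 + D * c (i + 1) else 0, rfl, fun _ => rfl⟩
    refine ⟨c', fun w => ?_, ?_, ?_, ?_⟩
    · have hshift : ∏ a ∈ Alt (n + 2), (w + (algebraMap A K (tk (n + 2)) + algebraMap A K a)) =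
          (∑ j ∈ Finset.range (n + 2), c j * w ^ 2 ^ j) + D := by
        simp only [← add_assoc]
        rw [hc, hDc, ← Finset.sum_add_distrib]
        simp only [add_pow_char_pow, mul_add]
      have hlin : ∑ j ∈ Finset.range (n + 2), c j * w ^ 2 ^ j =
          ∑ j ∈ Finset.range (n + 2), c (j + 1) * w ^ 2 ^ (j + 1) + c 0 * w := by
        have h := Finset.sum_range_succ' (fun j => c j * w ^ 2 ^ j) (n + 2)
        rw [Finset.sum_range_succ, h2, zero_mul, add_zero] at h
        simpa using h
      have hsucc : ∑ i ∈ Finset.range (n + 2),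
            c' (i + 1) * w ^ 2 ^ (i + 1) =
          (∑ i ∈ Finset.range (n + 2), c i * w ^ 2 ^ i) ^ 2 +
            D * ∑ i ∈ Finset.range (n + 2), c (i + 1) * w ^ 2 ^ (i + 1) := by
        rw [sum_pow_char 2, Finset.mul_sum, ← Finset.sum_add_distrib]
        refine Finset.sum_congr rfl fun i hi => ?_
        rw [hcs, if_pos (Finset.mem_range.mp hi)]
        ring
      rw [Alt_succ K (by omega), Finset.prod_union (disjoint_Alt_translate K (by omega)),
        Finset.prod_image fun _ _ _ _ h => add_right_injective _ h]
      simp only [map_add]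
      rw [hshift, hc, Finset.sum_range_succ' _ (n + 2), hsucc, hc0, pow_zero, pow_one, mul_add]
      linear_combination D * hlin
    · rw [hc0, Finset.prod_Icc_succ_top (by omega), ← h0, mul_comm]
    · simp [hcs, h1, h2]
    · simp [hcs]

theorem linearized_coeff_eq_zero {F : Type*} [Field F] {m : ℕ} {d : ℕ → F} {s : Finset F}
    (hs : 2 ^ m ≤ s.card) (h : ∀ w ∈ s, ∑ j ∈ Finset.range m, d j * w ^ 2 ^ j = 0)
    {i : ℕ} (hi : i < m) : d i = 0 := by
  set p : Polynomial F := ∑ j ∈ Finset.range m, C (d j) * X ^ 2 ^ j with hp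
  have hdeg : p.natDegree ≤ 2 ^ m - 1 := by
    refine natDegree_sum_le_of_forall_le _ _ fun j hj => ?_
    have : 2 ^ j < 2 ^ m := Nat.pow_lt_pow_right (by norm_num) (Finset.mem_range.mp hj)
    exact (natDegree_C_mul_X_pow_le _ _).trans (by omega)
  have hpos : 0 < 2 ^ m := by positivity
  have h0 : p = 0 := by
    refine eq_zero_of_natDegree_lt_card_of_eval_eq_zero' p s (fun w hw => ?_) (by omega)
    simpa [hp, eval_finsetSum] using h w hw
  have hc := congrArg (fun q => q.coeff (2 ^ i)) h0
  simpa [hp, finsetSum_coeff, coeff_X_pow, Nat.pow_right_inj, hi] using hc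

theorem expLogCoeff_eq_sum_range (k : ℕ) (z : K) : expLogCoeff K k z =
    ∑ j ∈ Finset.range (k + 1), aSeq K j * bSeq K (k - j) ^ 2 ^ j * z ^ 2 ^ j :=
  Finset.Nat.sum_antidiagonal_eq_sum_range_succ
    (fun i j => aSeq K i * bSeq K j ^ 2 ^ i * z ^ 2 ^ i) k

/-- `expLogCoeff K (n + 2)` is a combination of the square of `ePoly (n + 2)` and `ePoly (n + 2)`
itself, the coefficient `l` of the latter being pinned down by comparing linear terms. -/
theorem exists_expLogCoeff_eq [IsFractionRing A K] [CharP K 2] (n : ℕ) :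
    ∃ l : K, bSeq K (n + 2) = l * ∏ j ∈ Finset.Icc 2 (n + 1), algebraMap A K (Dk j) ∧
      ∀ w, expLogCoeff K (n + 2) w =
        aSeq K (n + 2) * (∏ a ∈ Alt (n + 2), (w + algebraMap A K a)) ^ 2 +
          l * ∏ a ∈ Alt (n + 2), (w + algebraMap A K a) := by
  obtain ⟨c, hc, h0, h1, h2⟩ := exists_linearized_prod_Alt K n
  set l := aSeq K (n + 1) * bSeq K 1 ^ 2 ^ (n + 1) - aSeq K (n + 2) * c n ^ 2 with hl
  obtain ⟨d, hd0, hds⟩ : ∃ d : ℕ → K, d 0 = bSeq K (n + 2) - l * c 0 ∧ ∀ i, d (i + 1) =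
      aSeq K (i + 1) * bSeq K (n + 1 - i) ^ 2 ^ (i + 1) - aSeq K (n + 2) * c i ^ 2 -
        l * c (i + 1) :=
    ⟨fun j => Nat.casesOn j (bSeq K (n + 2) - l * c 0) fun i =>
      aSeq K (i + 1) * bSeq K (n + 1 - i) ^ 2 ^ (i + 1) - aSeq K (n + 2) * c i ^ 2 -
        l * c (i + 1), rfl, fun _ => rfl⟩
  have hd : ∀ w, expLogCoeff K (n + 2) w -
      aSeq K (n + 2) * (∏ a ∈ Alt (n + 2), (w + algebraMap A K a)) ^ 2 -
        l * ∏ a ∈ Alt (n + 2), (w + algebraMap A K a) =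
      ∑ j ∈ Finset.range (n + 1), d j * w ^ 2 ^ j := by
    intro w
    have hlin : ∑ j ∈ Finset.range (n + 2), c j * w ^ 2 ^ j =
        ∑ j ∈ Finset.range (n + 2), c (j + 1) * w ^ 2 ^ (j + 1) + c 0 * w := by
      have h := Finset.sum_range_succ' (fun j => c j * w ^ 2 ^ j) (n + 2)
      rw [Finset.sum_range_succ, h2, zero_mul, add_zero] at h
      simpa using h
    have hsq : (∑ j ∈ Finset.range (n + 2), c j * w ^ 2 ^ j) ^ 2 =
        ∑ j ∈ Finset.range (n + 2), c j ^ 2 * w ^ 2 ^ (j + 1) := by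
      rw [sum_pow_char 2]
      exact Finset.sum_congr rfl fun i _ => by ring
    have hfull : expLogCoeff K (n + 2) w -
        aSeq K (n + 2) * (∏ a ∈ Alt (n + 2), (w + algebraMap A K a)) ^ 2 -
          l * ∏ a ∈ Alt (n + 2), (w + algebraMap A K a) =
        ∑ j ∈ Finset.range (n + 3), d j * w ^ 2 ^ j := by
      rw [hc, hsq, hlin, expLogCoeff_eq_sum_range, Finset.sum_range_succ',
        Finset.sum_range_succ' _ (n + 2)]
      have hterm : ∀ i, d (i + 1) * w ^ 2 ^ (i + 1) =
          aSeq K (i + 1) * bSeq K (n + 2 - (i + 1)) ^ 2 ^ (i + 1) * w ^ 2 ^ (i + 1) -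
            aSeq K (n + 2) * (c i ^ 2 * w ^ 2 ^ (i + 1)) -
              l * (c (i + 1) * w ^ 2 ^ (i + 1)) := by
        intro i
        rw [hds, show n + 2 - (i + 1) = n + 1 - i by omega]
        ring
      simp only [hterm, Finset.sum_sub_distrib, ← Finset.mul_sum]
      rw [hd0, show aSeq K 0 = 1 from rfl, pow_zero, pow_one, pow_one, Nat.sub_zero]
      ring
    have hd1 : d (n + 1) = 0 := by
      simp only [hds, h1, Nat.add_sub_cancel_left, hl]
      ring
    have hd2 : d (n + 2) = 0 := by
      simp only [hds, h1, h2, Nat.sub_self, bSeq]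
      ring
    rw [hfull, Finset.sum_range_succ, Finset.sum_range_succ, hd1, hd2]
    ring
  have hinj := IsFractionRing.injective A K
  have hvanish : ∀ w ∈ (Alt (n + 2)).image (algebraMap A K),
      ∑ j ∈ Finset.range (n + 1), d j * w ^ 2 ^ j = 0 := by
    intro w hw
    obtain ⟨a, ha, rfl⟩ := Finset.mem_image.mp hw
    have hprod : ∏ b ∈ Alt (n + 2), (algebraMap A K a + algebraMap A K b) = 0 :=
      Finset.prod_eq_zero ha (CharTwo.add_self_eq_zero _)
    rw [← hd, hprod, expLogCoeff_eq_zero_of_mem_Alt K ha]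
    ring
  have hzero : ∀ i < n + 1, d i = 0 := fun i hi =>
    linearized_coeff_eq_zero (by rw [Finset.card_image_of_injective _ hinj, card_Alt K])
      hvanish hi
  refine ⟨l, ?_, fun w => ?_⟩
  · rw [← h0]
    exact sub_eq_zero.mp (hd0.symm.trans (hzero 0 (by omega)))
  · have h := hd w
    rw [Finset.sum_eq_zero fun j hj => by rw [hzero j (Finset.mem_range.mp hj), zero_mul]] at h
    linear_combination h

/-- For every `k ≥ 2`:
`b_k·D_k = (1 + a_k·D_k²)·(D_{k-1}·D_{k-2}⋯D₂)` (the product being empty for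
`k = 2`).  Equivalently, with `d_k = 1/a_k` and `ℓ_k = 1/b_k`:
`ℓ_k = D_k·d_k / ((d_k + D_k²)·(D_{k-1}·D_{k-2}⋯D₂))`. -/
theorem stmt17 [IsFractionRing A K] (k : ℕ) (hk : 2 ≤ k) :
    bSeq K k * algebraMap A K (Dk k) =
      (1 + aSeq K k * (algebraMap A K (Dk k)) ^ 2) *
        ∏ j ∈ Finset.Icc 2 (k - 1), algebraMap A K (Dk j) := by
  have := charP_two_of_fractionRing K
  obtain ⟨n, rfl⟩ : ∃ n, k = n + 2 := ⟨k - 2, by omega⟩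
  obtain ⟨l, hl, h⟩ := exists_expLogCoeff_eq K n
  have ht := h (algebraMap A K (tk (n + 2)))
  rw [expLogCoeff_tk K hk, ← algebraMap_Dk] at ht
  have two : (2 : K) = 0 := CharTwo.two_eq_zero
  rw [show n + 2 - 1 = n + 1 by omega, hl]
  linear_combination (-∏ j ∈ Finset.Icc 2 (n + 1), algebraMap A K (Dk j)) * ht -
    aSeq K (n + 2) * algebraMap A K (Dk (n + 2)) ^ 2 *
      (∏ j ∈ Finset.Icc 2 (n + 1), algebraMap A K (Dk j)) * two
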